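/- arXiv:2602.17615 — 2 statements merged into one kernel-verified Lean document; each statement's English description precedes it below -/
import Mathlib

section
/- Consider an n-qubit Hamiltonian H = Σ_{i=1}^r c_i P_i where each P_i is a Pauli string of locality at most l, an n-qubit pure state ψ, and an arbitrary n-qubit unitary U acting nontrivially only on a set of m qubits. Let M^u denote the number of Hamiltonian terms whose support intersects the support of U, and c_max := max_{1≤i≤r}|c_i|. Then the single-shot energy-difference estimator ΔÊ, built from a single classical shadow of ψ obtained from a uniformly random local Pauli measurement, satisfies the almost-sure (deterministic, for every realization of basis and outcome) bound |ΔÊ| ≤ 2 M^u c_max · 4^m · 3^{l−1}. -/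
open Matrix Finset

namespace SEGQE

noncomputable section

/-- The space of `n`-qubit operators (`2^n × 2^n` complex matrices). -/
abbrev QMat (n : ℕ) := Matrix (Fin n → Fin 2) (Fin n → Fin 2) ℂ

/-- The space of `n`-qubit state vectors. -/
abbrev QVec (n : ℕ) := (Fin n → Fin 2) → ℂ

/-- The sample space of a single classical shadow: a choice of measurement basis
(one of `I, H, S†H` on each qubit) together with an outcome `b ∈ {0,1}^n`. -/
abbrev Shadow (n : ℕ) := (Fin n → Fin 3) × (Fin n → Fin 2)

/-- The identity and the three Pauli matrices `I, X, Y, Z` (encoded as `0, 1, 2, 3`). -/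
def pauli : Fin 4 → Matrix (Fin 2) (Fin 2) ℂ :=
  ![1, !![0, 1; 1, 0], !![0, -Complex.I; Complex.I, 0], !![1, 0; 0, -1]]

/-- The Pauli string (n-fold Kronecker product) determined by `s : Fin n → Fin 4`. -/
def PauliString {n : ℕ} (s : Fin n → Fin 4) : QMat n :=
  Matrix.of fun i j => ∏ k, pauli (s k) (i k) (j k)

/-- The weight (locality) of a Pauli string: the number of non-identity factors. -/
def wt {n : ℕ} (s : Fin n → Fin 4) : ℕ := (univ.filter fun k => s k ≠ 0).card

/-- The support of a Pauli string: the set of qubits with non-identity factor. -/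
def psupp {n : ℕ} (s : Fin n → Fin 4) : Finset (Fin n) := univ.filter fun k => s k ≠ 0

/-- The three single-qubit measurement rotations `I`, `H` (Hadamard) and `S†H`. -/
def meas1 : Fin 3 → Matrix (Fin 2) (Fin 2) ℂ :=
  ![1, ((Real.sqrt 2 : ℂ))⁻¹ • !![1, 1; 1, -1],
      ((Real.sqrt 2 : ℂ))⁻¹ • !![1, 1; -Complex.I, Complex.I]]

/-- The tensor-product measurement rotation `V = V^1 ⊗ ⋯ ⊗ V^n`. -/
def measMat {n : ℕ} (V : Fin n → Fin 3) : QMat n :=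
  Matrix.of fun i j => ∏ k, meas1 (V k) (i k) (j k)

/-- The Born probability `⟨b|VρV†|b⟩` of obtaining outcome `b` when measuring `ρ`
in the rotated basis `V`. -/
def bornProb {n : ℕ} (ρ : QMat n) (ω : Shadow n) : ℝ :=
  ((measMat ω.1 * ρ * (measMat ω.1)ᴴ) ω.2 ω.2).re

/-- The probability density of the classical-shadow sample `ω = (V, b)`: each basis
rotation is chosen uniformly at random (probability `3⁻ⁿ` per basis) and the outcome
is drawn with Born probability. -/
def shadowDensity {n : ℕ} (ρ : QMat n) (ω : Shadow n) : ℝ :=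
  ((3 : ℝ) ^ n)⁻¹ * bornProb ρ ω

/-- Expectation of a real function of a single classical shadow of `ρ`. -/
def shadowExp {n : ℕ} (ρ : QMat n) (f : Shadow n → ℝ) : ℝ :=
  ∑ ω : Shadow n, shadowDensity ρ ω * f ω

/-- The single-shot classical-shadow estimator `p̂ = 3^{wt s} ⟨b|V P V†|b⟩` of the
expectation value of the Pauli string `s`. -/
def estP {n : ℕ} (s : Fin n → Fin 4) (ω : Shadow n) : ℝ :=
  (3 : ℝ) ^ wt s * ((measMat ω.1 * PauliString s * (measMat ω.1)ᴴ) ω.2 ω.2).re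

/-- The (real) expectation value `⟨ψ|A|ψ⟩` of an observable `A` in the pure state `ψ`. -/
def expValRe {n : ℕ} (ψ : QVec n) (A : QMat n) : ℝ := (star ψ ⬝ᵥ A.mulVec ψ).re

/-- The density matrix `|ψ⟩⟨ψ|` of a pure state. -/
def pureDM {n : ℕ} (ψ : QVec n) : QMat n := vecMulVec ψ (star ψ)

/-- `A` acts nontrivially only on the qubits in `Q`, i.e. `A = B ⊗ I` with respect to the
bipartition of the qubits into `Q` and its complement. -/
def SupportedOn {n : ℕ} (Q : Finset (Fin n)) (A : QMat n) : Prop :=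
  ∃ B : Matrix ({k // k ∈ Q} → Fin 2) ({k // k ∈ Q} → Fin 2) ℂ,
    ∀ i j, A i j =
      if (∀ k ∉ Q, i k = j k) then B (fun k => i k.1) (fun k => j k.1) else 0

/-- The Pauli string equal to `μ` on `Q` and to the identity elsewhere (`P_μ^u ⊗ I`). -/
def onQ {n : ℕ} (Q : Finset (Fin n)) (μ : {k // k ∈ Q} → Fin 4) : Fin n → Fin 4 :=
  fun k => if h : k ∈ Q then μ ⟨k, h⟩ else 0

/-- The Pauli string equal to `μ` on `Q` and to `s` elsewhere (`P_μ^u ⊗ P_s^c`). -/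
def combo {n : ℕ} (Q : Finset (Fin n)) (μ : {k // k ∈ Q} → Fin 4) (s : Fin n → Fin 4) :
    Fin n → Fin 4 :=
  fun k => if h : k ∈ Q then μ ⟨k, h⟩ else s k

/-- Restriction of a Pauli string to the qubits in `Q` (the factor `P_s^u`). -/
def restrictQ {n : ℕ} (Q : Finset (Fin n)) (s : Fin n → Fin 4) : {k // k ∈ Q} → Fin 4 :=
  fun k => s k.1

/-- The expansion coefficient `r_{sμ} = 2^{−m} Tr(U† P_s^u U P_μ^u)` of the conjugated
Pauli string in the Pauli basis on `Q`, computed here with full-space traces as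
`2^{−n} Tr(U† (P_s^u ⊗ I) U (P_μ^u ⊗ I))`. -/
def rCoef {n : ℕ} (U : QMat n) (Q : Finset (Fin n)) (s : Fin n → Fin 4)
    (μ : {k // k ∈ Q} → Fin 4) : ℝ :=
  (((2 : ℂ) ^ n)⁻¹ *
    (Uᴴ * PauliString (onQ Q (restrictQ Q s)) * U * PauliString (onQ Q μ)).trace).re

/-- The coefficient `f_{sμ} = c (δ_{P_s^u, P_μ^u} − r_{sμ})`. -/
def fCoef {n : ℕ} (cc : ℝ) (U : QMat n) (Q : Finset (Fin n)) (s : Fin n → Fin 4)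
    (μ : {k // k ∈ Q} → Fin 4) : ℝ :=
  cc * ((if restrictQ Q s = μ then (1 : ℝ) else 0) - rCoef U Q s μ)

/-- The single-shot classical-shadow estimator `ΔÊ = Σ_{i∈I^u} Σ_μ f_{iμ} p̂_{iμ}` of the
energy difference induced by a gate `U` supported on `Q`, for the Hamiltonian
`H = Σ_i c_i P_{s_i}`; the outer sum ranges over the set `I^u` of Hamiltonian terms whose
support intersects `Q`. -/
def dEEst {n r : ℕ} (c : Fin r → ℝ) (s : Fin r → Fin n → Fin 4) (U : QMat n)
    (Q : Finset (Fin n)) (ω : Shadow n) : ℝ :=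
  ∑ i ∈ univ.filter (fun i => (psupp (s i) ∩ Q).Nonempty),
    ∑ μ : {k // k ∈ Q} → Fin 4, fCoef (c i) U Q (s i) μ * estP (combo Q μ (s i)) ω

/-- The Hamiltonian `H = Σ_i c_i P_{s_i}`. -/
def ham {n r : ℕ} (c : Fin r → ℝ) (s : Fin r → Fin n → Fin 4) : QMat n :=
  ∑ i, (c i : ℂ) • PauliString (s i)

/-- The true energy difference `ΔE = ⟨ψ|H|ψ⟩ − ⟨ψ|U†HU|ψ⟩`. -/
def dETrue {n r : ℕ} (c : Fin r → ℝ) (s : Fin r → Fin n → Fin 4) (ψ : QVec n)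
    (U : QMat n) : ℝ :=
  expValRe ψ (ham c s) - expValRe ψ (Uᴴ * ham c s * U)

/-- The Kronecker product of a family of single-qubit matrices. -/
def kronProd {n : ℕ} (A : Fin n → Matrix (Fin 2) (Fin 2) ℂ) : QMat n :=
  Matrix.of fun i j => ∏ k, A k (i k) (j k)

theorem kronProd_mul {n : ℕ} (A B : Fin n → Matrix (Fin 2) (Fin 2) ℂ) :
    kronProd A * kronProd B = kronProd fun k => A k * B k := by
  ext i j
  simp only [kronProd, Matrix.mul_apply, Matrix.of_apply, ← Finset.prod_mul_distrib]
  rw [Finset.prod_univ_sum, Fintype.piFinset_univ]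

theorem kronProd_conjTranspose {n : ℕ} (A : Fin n → Matrix (Fin 2) (Fin 2) ℂ) :
    (kronProd A)ᴴ = kronProd fun k => (A k)ᴴ := by
  ext i j
  simp [kronProd, Matrix.conjTranspose_apply]

theorem kronProd_one {n : ℕ} :
    kronProd (fun _ : Fin n => (1 : Matrix (Fin 2) (Fin 2) ℂ)) = 1 := by
  ext i j
  by_cases h : i = j
  · subst h
    simp [kronProd]
  · obtain ⟨k, hk⟩ := Function.ne_iff.mp h
    rw [Matrix.one_apply_ne h]
    exact Finset.prod_eq_zero (Finset.mem_univ k) (Matrix.one_apply_ne hk)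

theorem pauli_mul_conjTranspose (a : Fin 4) : pauli a * (pauli a)ᴴ = 1 := by
  fin_cases a <;> ext i j <;> fin_cases i <;> fin_cases j <;>
    simp [pauli, Matrix.mul_apply, Fin.sum_univ_two, Matrix.conjTranspose_apply]

theorem PauliString_mem_unitaryGroup {n : ℕ} (s : Fin n → Fin 4) :
    PauliString s ∈ Matrix.unitaryGroup (Fin n → Fin 2) ℂ := by
  rw [Matrix.mem_unitaryGroup_iff]
  change kronProd (fun k => pauli (s k)) * (kronProd fun k => pauli (s k))ᴴ = 1
  rw [kronProd_conjTranspose, kronProd_mul]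
  simp only [pauli_mul_conjTranspose, kronProd_one]

theorem norm_trace_le_of_mem_unitaryGroup {ι : Type*} [Fintype ι] [DecidableEq ι]
    {A : Matrix ι ι ℂ} (hA : A ∈ Matrix.unitaryGroup ι ℂ) :
    ‖A.trace‖ ≤ Fintype.card ι := by
  calc ‖A.trace‖ ≤ ∑ i, ‖A i i‖ := norm_sum_le _ _
    _ ≤ ∑ _i : ι, (1 : ℝ) :=
        Finset.sum_le_sum fun i _ => entry_norm_bound_of_unitary hA i i
    _ = Fintype.card ι := by simp

theorem abs_rCoef_le_one {n : ℕ} {U : QMat n} (hU : Uᴴ * U = 1) (Q : Finset (Fin n))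
    (s : Fin n → Fin 4) (μ : {k // k ∈ Q} → Fin 4) : |rCoef U Q s μ| ≤ 1 := by
  have hU' : U ∈ Matrix.unitaryGroup (Fin n → Fin 2) ℂ := Matrix.mem_unitaryGroup_iff'.mpr hU
  have hmem := mul_mem (mul_mem (mul_mem (Unitary.star_mem hU')
    (PauliString_mem_unitaryGroup (onQ Q (restrictQ Q s)))) hU')
    (PauliString_mem_unitaryGroup (onQ Q μ))
  have htr := norm_trace_le_of_mem_unitaryGroup hmem
  rw [Matrix.star_eq_conjTranspose] at htr
  refine (Complex.abs_re_le_norm _).trans ?_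
  rw [norm_mul, norm_inv, norm_pow, Complex.norm_ofNat, inv_mul_le_one₀ (by positivity)]
  simpa using htr

/-- The contribution of a single qubit, measured in basis `v` with outcome `b`, to the absolute
value of the shadow estimator of a Pauli string with factor `a` on that qubit. -/
def siteWeight (v : Fin 3) (b : Fin 2) (a : Fin 4) : ℝ :=
  (if a ≠ 0 then 3 else 1) * ‖(meas1 v * pauli a * (meas1 v)ᴴ) b b‖

theorem siteWeight_nonneg (v : Fin 3) (b : Fin 2) (a : Fin 4) : 0 ≤ siteWeight v b a := by
  unfold siteWeight
  positivity

theorem inv_sqrt_two_mul_self : ((Real.sqrt 2 : ℂ))⁻¹ * ((Real.sqrt 2 : ℂ))⁻¹ = 1 / 2 := by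
  rw [← mul_inv, ← Complex.ofReal_mul, Real.mul_self_sqrt (by norm_num)]
  norm_num

theorem meas1_pauli_diag (v : Fin 3) (b : Fin 2) (a : Fin 4) :
    ‖(meas1 v * pauli a * (meas1 v)ᴴ) b b‖ =
      if a = 0 ∨ a = (if v = 0 then 3 else 1) then 1 else 0 := by
  have hI : ((Real.sqrt 2 : ℂ))⁻¹ * Complex.I * (((Real.sqrt 2 : ℂ))⁻¹ * Complex.I) = -(1 / 2) := by
    rw [mul_mul_mul_comm, inv_sqrt_two_mul_self, Complex.I_mul_I]
    ring
  fin_cases v <;> fin_cases b <;> fin_cases a <;>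
    simp [meas1, pauli, Matrix.mul_apply, Fin.sum_univ_two, Matrix.conjTranspose_apply,
      Matrix.one_apply] <;>
    simp only [inv_sqrt_two_mul_self, hI] <;> norm_num

theorem siteWeight_le (v : Fin 3) (b : Fin 2) (a : Fin 4) :
    siteWeight v b a ≤ if a ≠ 0 then 3 else 1 := by
  rw [siteWeight, meas1_pauli_diag]
  split_ifs <;> norm_num

theorem sum_siteWeight (v : Fin 3) (b : Fin 2) : ∑ a, siteWeight v b a = 4 := by
  simp only [siteWeight, meas1_pauli_diag, Fin.sum_univ_four]
  fin_cases v <;> norm_num [Fin.ext_iff]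

theorem abs_estP_le {n : ℕ} (s : Fin n → Fin 4) (ω : Shadow n) :
    |estP s ω| ≤ ∏ k, siteWeight (ω.1 k) (ω.2 k) (s k) := by
  have hdiag : (measMat ω.1 * PauliString s * (measMat ω.1)ᴴ) ω.2 ω.2 =
      ∏ k, (meas1 (ω.1 k) * pauli (s k) * (meas1 (ω.1 k))ᴴ) (ω.2 k) (ω.2 k) := by
    change (kronProd (fun k => meas1 (ω.1 k)) * kronProd (fun k => pauli (s k)) *
      (kronProd fun k => meas1 (ω.1 k))ᴴ) ω.2 ω.2 = _
    rw [kronProd_conjTranspose, kronProd_mul, kronProd_mul]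
    rfl
  have hwt : (3 : ℝ) ^ wt s = ∏ k, if s k ≠ 0 then (3 : ℝ) else 1 := by
    rw [Finset.prod_ite, Finset.prod_const, Finset.prod_const_one, mul_one, wt]
  rw [estP, abs_mul, abs_of_nonneg (by positivity : (0 : ℝ) ≤ 3 ^ wt s)]
  simp only [siteWeight]
  rw [Finset.prod_mul_distrib, ← norm_prod, ← hdiag, hwt]
  refine mul_le_mul_of_nonneg_left (Complex.abs_re_le_norm _) ?_
  exact Finset.prod_nonneg fun k _ => by split_ifs <;> norm_num

theorem prod_combo {n : ℕ} (Q : Finset (Fin n)) (g : Fin n → Fin 4 → ℝ)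
    (s : Fin n → Fin 4) (μ : {k // k ∈ Q} → Fin 4) :
    ∏ k, g k (combo Q μ s k) = (∏ k : {k // k ∈ Q}, g k (μ k)) * ∏ k ∈ Qᶜ, g k (s k) := by
  rw [← Finset.prod_mul_prod_compl Q, ← Finset.prod_coe_sort Q]
  congr 1
  · exact Finset.prod_congr rfl fun k _ => by simp [combo]
  · refine Finset.prod_congr rfl fun k hk => ?_
    rw [combo, dif_neg (Finset.mem_compl.mp hk)]

theorem prod_compl_siteWeight_le {n l : ℕ} {Q : Finset (Fin n)} {s : Fin n → Fin 4}
    (hs : wt s ≤ l) (hQ : (psupp s ∩ Q).Nonempty) (ω : Shadow n) :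
    ∏ k ∈ Qᶜ, siteWeight (ω.1 k) (ω.2 k) (s k) ≤ (3 : ℝ) ^ (l - 1) := by
  have hcard : (Qᶜ.filter fun k => s k ≠ 0).card ≤ l - 1 := by
    obtain ⟨k, hk⟩ := hQ
    rw [Finset.mem_inter] at hk
    have hlt : (Qᶜ.filter fun k => s k ≠ 0).card < (psupp s).card := by
      refine Finset.card_lt_card ⟨fun j hj => ?_, fun hsub => ?_⟩
      · simpa [psupp] using (Finset.mem_filter.mp hj).2
      · exact Finset.mem_compl.mp (Finset.mem_filter.mp (hsub hk.1)).1 hk.2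
    have : (psupp s).card ≤ l := hs
    omega
  calc ∏ k ∈ Qᶜ, siteWeight (ω.1 k) (ω.2 k) (s k)
      ≤ ∏ k ∈ Qᶜ, (if s k ≠ 0 then (3 : ℝ) else 1) :=
        Finset.prod_le_prod (fun k _ => siteWeight_nonneg _ _ _) fun k _ => siteWeight_le _ _ _
    _ = (3 : ℝ) ^ (Qᶜ.filter fun k => s k ≠ 0).card := by
        rw [Finset.prod_ite, Finset.prod_const, Finset.prod_const_one, mul_one]
    _ ≤ (3 : ℝ) ^ (l - 1) := pow_le_pow_right₀ (by norm_num) hcard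

theorem sum_abs_estP_combo_le {n l : ℕ} {Q : Finset (Fin n)} {s : Fin n → Fin 4}
    (hs : wt s ≤ l) (hQ : (psupp s ∩ Q).Nonempty) (ω : Shadow n) :
    ∑ μ : {k // k ∈ Q} → Fin 4, |estP (combo Q μ s) ω| ≤
      (4 : ℝ) ^ Q.card * (3 : ℝ) ^ (l - 1) := by
  calc ∑ μ : {k // k ∈ Q} → Fin 4, |estP (combo Q μ s) ω|
      ≤ ∑ μ : {k // k ∈ Q} → Fin 4, (∏ k : {k // k ∈ Q}, siteWeight (ω.1 k) (ω.2 k) (μ k)) *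
          ∏ k ∈ Qᶜ, siteWeight (ω.1 k) (ω.2 k) (s k) :=
        Finset.sum_le_sum fun μ _ => (abs_estP_le _ ω).trans_eq
          (prod_combo Q (fun k => siteWeight (ω.1 k) (ω.2 k)) s μ)
    _ = (4 : ℝ) ^ Q.card * ∏ k ∈ Qᶜ, siteWeight (ω.1 k) (ω.2 k) (s k) := by
        rw [← Finset.sum_mul, ← Fintype.piFinset_univ, ← Finset.prod_univ_sum]
        simp [sum_siteWeight]
    _ ≤ (4 : ℝ) ^ Q.card * (3 : ℝ) ^ (l - 1) :=
        mul_le_mul_of_nonneg_left (prod_compl_siteWeight_le hs hQ ω) (by positivity)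

theorem abs_fCoef_le {n : ℕ} (cc : ℝ) {U : QMat n} (hU : Uᴴ * U = 1) (Q : Finset (Fin n))
    (s : Fin n → Fin 4) (μ : {k // k ∈ Q} → Fin 4) : |fCoef cc U Q s μ| ≤ 2 * |cc| := by
  have hr := abs_le.mp (abs_rCoef_le_one hU Q s μ)
  rw [fCoef, abs_mul, mul_comm]
  refine mul_le_mul_of_nonneg_right ?_ (abs_nonneg _)
  rw [abs_le]
  split_ifs <;> constructor <;> linarith

/-- **Almost-sure single-shot bound for energy-difference estimators.**
Consider an `n`-qubit Hamiltonian `H = Σ_{i=1}^r c_i P_i` with Pauli strings of locality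
at most `l`, a pure state `ψ`, and an `n`-qubit unitary `U` acting nontrivially only on a
set `Q` of `m` qubits.  With `M^u` the number of Hamiltonian terms whose support
intersects the support of `U` and `c_max := max_i |c_i|`, the single-shot
energy-difference estimator `ΔÊ` satisfies, for every realization `ω` of measurement
basis and outcome, `|ΔÊ(ω)| ≤ 2 M^u c_max · 4^m · 3^{l−1}`. -/
theorem single_shot_bound_energy_difference_estimator {n r l m : ℕ} (hl : 1 ≤ l)
    (c : Fin r → ℝ) (s : Fin r → Fin n → Fin 4) (hloc : ∀ i, wt (s i) ≤ l)
    (ψ : QVec n) (hψ : star ψ ⬝ᵥ ψ = 1)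
    (U : QMat n) (hU : Uᴴ * U = 1)
    (Q : Finset (Fin n)) (hQ : SupportedOn Q U) (hQm : Q.card = m)
    (cmax : ℝ) (hcmax : IsGreatest (Set.range fun i => |c i|) cmax) :
    ∀ ω : Shadow n,
      |dEEst c s U Q ω| ≤
        2 * ((univ.filter fun i => (psupp (s i) ∩ Q).Nonempty).card : ℝ) * cmax *
          (4 : ℝ) ^ m * (3 : ℝ) ^ (l - 1) := by
  intro ω
  subst hQm
  have hterm : ∀ i ∈ univ.filter (fun i => (psupp (s i) ∩ Q).Nonempty),
      |∑ μ : {k // k ∈ Q} → Fin 4, fCoef (c i) U Q (s i) μ * estP (combo Q μ (s i)) ω| ≤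
        2 * cmax * ((4 : ℝ) ^ Q.card * (3 : ℝ) ^ (l - 1)) := by
    intro i hi
    have hci : |c i| ≤ cmax := hcmax.2 ⟨i, rfl⟩
    have hcm : 0 ≤ cmax := (abs_nonneg _).trans hci
    calc |∑ μ : {k // k ∈ Q} → Fin 4, fCoef (c i) U Q (s i) μ * estP (combo Q μ (s i)) ω|
        ≤ ∑ μ : {k // k ∈ Q} → Fin 4, |fCoef (c i) U Q (s i) μ * estP (combo Q μ (s i)) ω| :=
          Finset.abs_sum_le_sum_abs _ _
      _ ≤ ∑ μ : {k // k ∈ Q} → Fin 4, 2 * cmax * |estP (combo Q μ (s i)) ω| := by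
          refine Finset.sum_le_sum fun μ _ => ?_
          rw [abs_mul]
          refine mul_le_mul_of_nonneg_right ?_ (abs_nonneg _)
          linarith [abs_fCoef_le (c i) hU Q (s i) μ]
      _ ≤ 2 * cmax * ((4 : ℝ) ^ Q.card * (3 : ℝ) ^ (l - 1)) := by
          rw [← Finset.mul_sum]
          exact mul_le_mul_of_nonneg_left
            (sum_abs_estP_combo_le (hloc i) (Finset.mem_filter.mp hi).2 ω) (by positivity)
  calc |dEEst c s U Q ω| ≤ _ := Finset.abs_sum_le_sum_abs _ _
    _ ≤ _ := Finset.sum_le_card_nsmul _ _ _ hterm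
    _ = _ := by
        rw [nsmul_eq_mul]
        ring

end

end SEGQE
end

section
/- Let X be a Hermitian 2^n×2^n complex matrix with X² = I, let H be a Hermitian 2^n×2^n matrix, and let ψ be a unit vector in ℂ^{2^n}. Define U(θ) := exp(−i(θ/2)X), A := ⟨ψ|H|ψ⟩ − ⟨ψ|XHX|ψ⟩, and B := ⟨ψ|i(XH − HX)|ψ⟩. Then for every real θ, ⟨ψ|H|ψ⟩ − ⟨ψ|U(θ)^†HU(θ)|ψ⟩ = (1/2)(A − A cos θ − B sin θ). -/
open Matrix Finset

namespace SEGQE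

noncomputable section

/-- Matrix exponential `exp(A) = Σ_k A^k / k!`. -/
def mexp {n : ℕ} (A : QMat n) : QMat n := ∑' k : ℕ, ((k.factorial : ℂ))⁻¹ • A ^ k

/-- The rotation gate `U(θ) = exp(−i(θ/2)X)`. -/
def rotGate {n : ℕ} (X : QMat n) (θ : ℝ) : QMat n :=
  mexp ((-((θ : ℂ) / 2) * Complex.I) • X)

/-- The exponential of a scalar multiple of an involution splits into its `cosh` and `sinh`
parts. -/
lemma mexp_smul_of_sq_eq_one {n : ℕ} {X : QMat n} (hX2 : X ^ 2 = 1) (z : ℂ) :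
    mexp (z • X) = Complex.cosh z • (1 : QMat n) + Complex.sinh z • X := by
  have hexp : ∀ w : ℂ, HasSum (fun k : ℕ => ((k.factorial : ℂ))⁻¹ * w ^ k) (Complex.exp w) := by
    intro w
    rw [Complex.exp_eq_exp_ℂ]
    simpa only [smul_eq_mul] using NormedSpace.exp_series_hasSum_exp' (𝕂 := ℂ) w
  have hcosh := (((hexp z).add (hexp (-z))).div_const 2).smul_const (1 : QMat n)
  have hsinh := (((hexp z).sub (hexp (-z))).div_const 2).smul_const X
  refine ((hcosh.add hsinh).congr_fun fun k => ?_).tsum_eq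
  rcases Nat.even_or_odd' k with ⟨m, rfl | rfl⟩
  · have hpow : X ^ (2 * m) = 1 := by rw [pow_mul, hX2, one_pow]
    rw [smul_pow, hpow, smul_smul, Even.neg_pow (even_two_mul m)]
    simp
  · have hpow : X ^ (2 * m + 1) = X := by rw [pow_succ, pow_mul, hX2, one_pow, one_mul]
    rw [smul_pow, hpow, smul_smul, Odd.neg_pow (odd_two_mul_add_one m)]
    simp

/-- Euler's formula for the rotation gate of an involution. -/
lemma rotGate_of_sq_eq_one {n : ℕ} {X : QMat n} (hX2 : X ^ 2 = 1) (θ : ℝ) :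
    rotGate X θ = (Real.cos (θ / 2) : ℂ) • (1 : QMat n)
      - (Real.sin (θ / 2) * Complex.I : ℂ) • X := by
  rw [rotGate, mexp_smul_of_sq_eq_one hX2, Complex.cosh_mul_I, Complex.sinh_mul_I,
    Complex.cos_neg, Complex.sin_neg, neg_mul, neg_smul, ← sub_eq_add_neg]
  push_cast
  rfl

/-- Conjugating an observable by the rotation gate of a Hermitian involution. -/
lemma rotGate_conj {n : ℕ} {X : QMat n} (hX : Xᴴ = X) (hX2 : X ^ 2 = 1) (H : QMat n) (θ : ℝ) :
    (rotGate X θ)ᴴ * H * rotGate X θ =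
      (Real.cos (θ / 2) ^ 2) • H + (Real.sin (θ / 2) ^ 2) • (X * H * X)
        + (Real.sin (θ / 2) * Real.cos (θ / 2)) • (Complex.I • (X * H - H * X)) := by
  have hstar : (rotGate X θ)ᴴ = (Real.cos (θ / 2) : ℂ) • (1 : QMat n)
      + (Real.sin (θ / 2) * Complex.I : ℂ) • X := by
    rw [rotGate_of_sq_eq_one hX2, conjTranspose_sub, conjTranspose_smul, conjTranspose_smul,
      conjTranspose_one, hX]
    simp [-Complex.ofReal_cos, -Complex.ofReal_sin]
  rw [hstar, rotGate_of_sq_eq_one hX2]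
  simp only [add_mul, mul_sub, smul_mul_assoc, mul_smul_comm, one_mul, mul_one]
  ext i j
  simp only [Matrix.add_apply, Matrix.sub_apply, Matrix.smul_apply, smul_eq_mul, Complex.real_smul,
    Complex.ofReal_mul, Complex.ofReal_pow]
  linear_combination (-(Real.sin (θ / 2) : ℂ) ^ 2 * (X * H * X) i j) * Complex.I_sq

lemma expValRe_add {n : ℕ} (ψ : QVec n) (M N : QMat n) :
    expValRe ψ (M + N) = expValRe ψ M + expValRe ψ N := by
  simp [expValRe, add_mulVec, dotProduct_add]

lemma expValRe_smul {n : ℕ} (ψ : QVec n) (r : ℝ) (M : QMat n) :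
    expValRe ψ (r • M) = r * expValRe ψ M := by
  simp [expValRe, smul_mulVec, dotProduct_smul]

/-- **Trigonometric form of the energy difference for an involutory generator.**
Let `X` be Hermitian with `X² = I`, let `H` be Hermitian, and let `ψ` be a unit vector.
With `U(θ) := exp(−i(θ/2)X)`, `A := ⟨ψ|H|ψ⟩ − ⟨ψ|XHX|ψ⟩` and `B := ⟨ψ|i(XH − HX)|ψ⟩`,
for every real `θ` one has `⟨ψ|H|ψ⟩ − ⟨ψ|U(θ)†HU(θ)|ψ⟩ = (1/2)(A − A cos θ − B sin θ)`. -/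
theorem energy_difference_trig_form {n : ℕ} (X H : QMat n)
    (hX : Xᴴ = X) (hX2 : X ^ 2 = 1) (hH : Hᴴ = H)
    (ψ : QVec n) (hψ : star ψ ⬝ᵥ ψ = 1) (θ : ℝ) :
    expValRe ψ H - expValRe ψ ((rotGate X θ)ᴴ * H * rotGate X θ) =
      ((expValRe ψ H - expValRe ψ (X * H * X))
        - (expValRe ψ H - expValRe ψ (X * H * X)) * Real.cos θ
        - expValRe ψ (Complex.I • (X * H - H * X)) * Real.sin θ) / 2 := by
  have hcos : Real.cos θ = 2 * Real.cos (θ / 2) ^ 2 - 1 := by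
    rw [← Real.cos_two_mul, mul_div_cancel₀ θ two_ne_zero]
  have hsin : Real.sin θ = 2 * Real.sin (θ / 2) * Real.cos (θ / 2) := by
    rw [← Real.sin_two_mul, mul_div_cancel₀ θ two_ne_zero]
  rw [rotGate_conj hX hX2, expValRe_add, expValRe_add, expValRe_smul, expValRe_smul,
    expValRe_smul, hcos, hsin, Real.sin_sq]
  ring

end

end SEGQE
end
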